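/- Let κ be a regular infinite cardinal, let Λ denote the well-ordered type of ordinals below κ (a linear order of cofinality κ), let P be a partially ordered set and i ∈ {1, 2, 3}. If a κ-sequence f : Λ → P converges to x ∈ P with respect to the topology τ^κ_{Oᵢ}(P), then there exists an isotone (order-preserving) function ĥ : Λ → Λ with cofinal range such that the κ-sequence f ∘ ĥ Oᵢ-converges to x. -/

import Mathlib

/-- O₃-convergence with nonempty witnessing sets. -/
def O3nConverges {P : Type*} [PartialOrder P] {Γ : Type*} [Preorder Γ]
    (x : Γ → P) (a : P) : Prop :=
  ∃ M N : Set P, M.Nonempty ∧ N.Nonempty ∧ IsLUB M a ∧ IsGLB N a ∧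
    ∀ m ∈ M, ∀ n ∈ N, ∃ γ₀, ∀ γ, γ₀ ≤ γ → m ≤ x γ ∧ x γ ≤ n

lemma O3nConverges.le {P Γ : Type*} [PartialOrder P] [LinearOrder Γ] {x : Γ → P} {a b : P}
    (ha : O3nConverges x a) (hb : O3nConverges x b) : a ≤ b := by
  obtain ⟨M, N, -, ⟨n, hn⟩, hM, -, h⟩ := ha
  obtain ⟨M', N', ⟨m', hm'⟩, -, -, hN', h'⟩ := hb
  refine hM.2 fun m hm => hN'.2 fun n' hn' => ?_
  obtain ⟨c, hc⟩ := h m hm n hn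
  obtain ⟨d, hd⟩ := h' m' hm' n' hn'
  exact (hc _ (le_max_left c d)).1.trans (hd _ (le_max_right c d)).2

/-- A value attained cofinally is the limit. -/
lemma O3nConverges.eq_of_freq {P Γ : Type*} [PartialOrder P] [LinearOrder Γ] {x : Γ → P}
    {a v : P} (ha : O3nConverges x a) (hv : ∀ i, ∃ j, i ≤ j ∧ x j = v) : v = a := by
  obtain ⟨M, N, ⟨m₀, hm₀⟩, ⟨n₀, hn₀⟩, hM, hN, h⟩ := ha
  apply le_antisymm
  · refine hN.2 fun n hn => ?_
    obtain ⟨c, hc⟩ := h m₀ hm₀ n hn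
    obtain ⟨j, hj, rfl⟩ := hv c
    exact (hc _ hj).2
  · refine hM.2 fun m hm => ?_
    obtain ⟨c, hc⟩ := h m hm n₀ hn₀
    obtain ⟨j, hj, rfl⟩ := hv c
    exact (hc _ hj).1

lemma kappa_comb {P Λ : Type*} [LinearOrder Λ] [WellFoundedLT Λ]
    (hb : ∀ (B : Λ) (φ : Set.Iio B → Λ), ∃ u, ∀ j, φ j < u)
    (g F : Λ → P) (h1 : ∃ j0, ∀ j, j0 ≤ j → ∃ i, g j = F i)
    (h2 : ∀ i, ∃ j0, ∀ j, j0 ≤ j → g j ≠ F i) :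
    ∃ p q : Λ → Λ, StrictMono p ∧ StrictMono q ∧ g ∘ p = F ∘ q := by
  obtain ⟨j0, hj0⟩ := h1
  choose J hJ using h2
  have key : ∀ (j : Λ) (r : ∀ j', j' < j → Λ × Λ), ∃ s : Λ × Λ,
      (∀ j' h, (r j' h).1 < s.1 ∧ (r j' h).2 < s.2) ∧ g s.1 = F s.2 := by
    intro j r
    obtain ⟨u, hu⟩ := hb j (fun j' => (r j'.1 j'.2).1)
    obtain ⟨v, hv⟩ := hb j (fun j' => (r j'.1 j'.2).2)
    obtain ⟨w, hw⟩ := hb v (fun i => J i.1)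
    obtain ⟨i, hi⟩ := hj0 (max (max u w) j0) (le_max_right _ _)
    have hvi : v ≤ i := by
      by_contra hlt
      push Not at hlt
      exact hJ i _ ((hw ⟨i, hlt⟩).le.trans
        ((le_max_right u w).trans (le_max_left _ _))) hi
    refine ⟨(max (max u w) j0, i), fun j' h => ⟨?_, ?_⟩, hi⟩
    · exact (hu ⟨j', h⟩).trans_le ((le_max_left u w).trans (le_max_left _ _))
    · exact (hv ⟨j', h⟩).trans_le hvi
  choose s hs using key
  let wf : WellFounded (fun x y : Λ => x < y) := wellFounded_lt
  let r : Λ → Λ × Λ := wf.fix s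
  have hr : ∀ j, r j = s j (fun j' _ => r j') := fun j => wf.fix_eq s j
  have hr' : ∀ j, (∀ j' < j, (r j').1 < (r j).1 ∧ (r j').2 < (r j).2) ∧
      g (r j).1 = F (r j).2 := by
    intro j
    have := hs j (fun j' _ => r j')
    rw [← hr j] at this
    exact this
  exact ⟨fun j => (r j).1, fun j => (r j).2, fun i j h => ((hr' j).1 i h).1,
    fun i j h => ((hr' j).1 i h).2, funext fun j => (hr' j).2⟩

lemma kappa_main {P Λ : Type*} [PartialOrder P] [LinearOrder Λ] [WellFoundedLT Λ]
    (hb : ∀ (B : Λ) (φ : Set.Iio B → Λ), ∃ u, ∀ j, φ j < u)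
    (Conv : (Λ → P) → P → Prop) (E : Set P)
    (hconst : ∀ v, Conv (fun _ => v) v)
    (hsub : ∀ g b (p : Λ → Λ), StrictMono p → Conv g b → Conv (g ∘ p) b)
    (hO : ∀ g b, b ∉ E → Conv g b → O3nConverges g b)
    (hE : ∀ g b, b ∉ E → Conv g b → ∃ j0, ∀ j, j0 ≤ j → g j ∉ E)
    (hEa : ∀ g, ∀ b ∈ E, Conv g b)
    (f : Λ → P) (a : P)
    (htop : ∀ U : Set P, (∀ g : Λ → P, (∀ i, g i ∈ Uᶜ) → ∀ c, Conv g c → c ∈ Uᶜ) → a ∈ U →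
      ∃ i₀, ∀ i, i₀ ≤ i → f i ∈ U) :
    ∃ h : Λ → Λ, Monotone h ∧ (∀ i, ∃ j, i ≤ h j) ∧ Conv (f ∘ h) a := by
  have htop' : ∀ X : Set P, a ∉ X → (∀ i, ∃ j, i ≤ j ∧ f j ∈ X) →
      ∃ g : Λ → P, (∀ i, g i ∈ X) ∧ ∃ c, Conv g c ∧ c ∉ X := by
    intro X ha hf
    by_contra hcon
    push Not at hcon
    obtain ⟨i0, hi0⟩ := htop Xᶜ (by rw [compl_compl]; exact hcon) ha
    obtain ⟨j, hj, hjX⟩ := hf i0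
    exact hi0 j hj hjX
  by_cases haE : a ∈ E
  · exact ⟨id, monotone_id, fun i => ⟨i, le_rfl⟩, hEa _ _ haE⟩
  by_cases hfa : ∀ i, ∃ j, i ≤ j ∧ f j = a
  · let S : Λ → Set Λ := fun i => {j | i ≤ j ∧ f j = a}
    let wf : WellFounded (fun x y : Λ => x < y) := wellFounded_lt
    let h : Λ → Λ := fun i => wf.min (S i) (hfa i)
    have hh : ∀ i, i ≤ h i ∧ f (h i) = a := fun i => wf.min_mem (S i) (hfa i)
    refine ⟨h, ?_, fun i => ⟨i, (hh i).1⟩, ?_⟩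
    · intro i j hij
      have : h j ∈ S i := ⟨hij.trans (hh j).1, (hh j).2⟩
      exact not_lt.1 (wf.not_lt_min (S i) this)
    · have : f ∘ h = fun _ => a := funext fun i => (hh i).2
      rw [this]
      exact hconst a
  push Not at hfa
  obtain ⟨i0, hi0⟩ := hfa
  -- extraction
  have extract : ∀ (F : Λ → P) (g : Λ → P) (c : P), Conv g c → c ∉ E → c ∉ Set.range F →
      (∃ j0, ∀ j, j0 ≤ j → g j ∈ Set.range F) →
      ∃ p q : Λ → Λ, StrictMono p ∧ StrictMono q ∧ g ∘ p = F ∘ q := by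
    intro F g c hc hcE hcF hev
    refine kappa_comb hb g F ?_ ?_
    · obtain ⟨j0, hj0⟩ := hev
      exact ⟨j0, fun j hj => by obtain ⟨i, hi⟩ := hj0 j hj; exact ⟨i, hi.symm⟩⟩
    · intro i
      by_contra hcon
      push Not at hcon
      exact hcF ⟨i, (hO g c hcE hc).eq_of_freq hcon⟩
  let F : Λ → P := fun i => f (max i0 i)
  obtain ⟨g, hg, b, hgb, hbX⟩ := htop' (Set.range F ∪ E) (by
      rintro (⟨i, hi⟩ | h)
      · exact hi0 _ (le_max_left i0 i) hi
      · exact haE h) (fun i => ⟨max i0 i, le_max_right _ _, Or.inl ⟨i, rfl⟩⟩)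
  have hbF : b ∉ Set.range F := fun h => hbX (Or.inl h)
  have hbE : b ∉ E := fun h => hbX (Or.inr h)
  obtain ⟨p, q, hp, hq, hpq⟩ := extract F g b hgb hbE hbF (by
    obtain ⟨j0, hj0⟩ := hE g b hbE hgb
    exact ⟨j0, fun j hj => (hg j).resolve_right (hj0 j hj)⟩)
  have hFq : Conv (F ∘ q) b := hpq ▸ hsub g b p hp hgb
  by_cases hba : b = a
  · subst hba
    refine ⟨fun i => max i0 (q i), fun i j hij => max_le_max le_rfl (hq.monotone hij),
      fun i => ⟨i, (hq.le_apply).trans (le_max_right _ _)⟩, hFq⟩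
  exfalso
  obtain ⟨g', hg', c, hgc, hcX⟩ := htop' (Set.range (F ∘ q) ∪ ({b} ∪ E)) (by
      rintro (⟨i, hi⟩ | h | h)
      · exact hi0 _ (le_max_left i0 (q i)) hi
      · exact hba h.symm
      · exact haE h)
    (fun i => ⟨max i0 (q i), (hq.le_apply).trans (le_max_right _ _), Or.inl ⟨i, rfl⟩⟩)
  have hcF : c ∉ Set.range (F ∘ q) := fun h => hcX (Or.inl h)
  have hcb : c ≠ b := fun h => hcX (Or.inr (Or.inl h))
  have hcE : c ∉ E := fun h => hcX (Or.inr (Or.inr h))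
  obtain ⟨p', q', hp', hq', hpq'⟩ := extract (F ∘ q) g' c hgc hcE hcF (by
    obtain ⟨j0, hj0⟩ := hE g' c hcE hgc
    have : ∃ j1, ∀ j, j1 ≤ j → g' j ≠ b := by
      by_contra hcon
      push Not at hcon
      exact hcb ((hO g' c hcE hgc).eq_of_freq hcon).symm
    obtain ⟨j1, hj1⟩ := this
    refine ⟨max j0 j1, fun j hj => (hg' j).resolve_right ?_⟩
    rintro (h | h)
    · exact hj1 j ((le_max_right _ _).trans hj) h
    · exact hj0 j ((le_max_left _ _).trans hj) h)
  have c1 : O3nConverges (g' ∘ p') c := hO _ _ hcE (hsub _ _ _ hp' hgc)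
  have c2 : O3nConverges (g' ∘ p') b := hO _ _ hbE (hpq' ▸ hsub _ _ _ hq' hFq)
  exact hcb (le_antisymm (c1.le c2) (c2.le c1))

lemma kappa_bdd {κ : Cardinal} (hκ : κ.IsRegular) (B : {o : Ordinal // o < κ.ord})
    (φ : Set.Iio B → {o : Ordinal // o < κ.ord}) : ∃ u, ∀ j, φ j < u := by
  let ψ : B.1.ToType → Ordinal := fun t =>
    Order.succ (φ ⟨⟨Ordinal.typein (α := B.1.ToType) (· < ·) t, (Ordinal.typein_lt_self t).trans B.2⟩, Ordinal.typein_lt_self t⟩).1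
  have hlim : Order.IsSuccLimit κ.ord := Cardinal.isSuccLimit_ord hκ.aleph0_le
  have hlt : iSup ψ < κ.ord := by
    apply Ordinal.iSup_lt_of_lt_cof
    · rw [hκ.cof_ord, Cardinal.mk_toType]
      exact Cardinal.lt_ord.1 B.2
    · intro i
      exact hlim.succ_lt (Subtype.prop _)
  refine ⟨⟨iSup ψ, hlt⟩, fun j => ?_⟩
  have hj : j.1.1 < B.1 := j.2
  have hmem : j.1.1 < Ordinal.type (α := B.1.ToType) (· < ·) := by simpa using hj
  have := Ordinal.le_iSup ψ (Ordinal.enum (α := B.1.ToType) (· < ·) ⟨j.1.1, hmem⟩)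
  refine Subtype.mk_lt_mk.2 (lt_of_lt_of_le ?_ this)
  simp [ψ]


universe u

/-- A net `x : Γ → P` O₁-converges to `a`: there are a monotone increasing net `y` with
least upper bound of its range `a` and a monotone decreasing net `z` with greatest lower
bound of its range `a`, with eventually `y γ ≤ x γ ≤ z γ`. -/
def O1Converges {P : Type*} [PartialOrder P] {Γ : Type*} [Preorder Γ]
    (x : Γ → P) (a : P) : Prop :=
  ∃ y z : Γ → P, Monotone y ∧ Antitone z ∧
    IsLUB (Set.range y) a ∧ IsGLB (Set.range z) a ∧
    ∃ γ₀, ∀ γ, γ₀ ≤ γ → y γ ≤ x γ ∧ x γ ≤ z γ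

/-- A net `x : Γ → P` O₂-converges to `a`: there are an upward-directed set `M` with
`IsLUB M a` and a downward-directed set `N` with `IsGLB N a` such that for every
`(m, n) ∈ M × N`, eventually `m ≤ x γ ≤ n`. -/
def O2Converges {P : Type*} [PartialOrder P] {Γ : Type*} [Preorder Γ]
    (x : Γ → P) (a : P) : Prop :=
  ∃ M N : Set P, M.Nonempty ∧ DirectedOn (· ≤ ·) M ∧ N.Nonempty ∧ DirectedOn (· ≥ ·) N ∧
    IsLUB M a ∧ IsGLB N a ∧
    ∀ m ∈ M, ∀ n ∈ N, ∃ γ₀, ∀ γ, γ₀ ≤ γ → m ≤ x γ ∧ x γ ≤ n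

/-- A net `x : Γ → P` O₃-converges to `a`: there are sets `M`, `N` with `IsLUB M a` and
`IsGLB N a` such that for every `(m, n) ∈ M × N`, eventually `m ≤ x γ ≤ n`. -/
def O3Converges {P : Type*} [PartialOrder P] {Γ : Type*} [Preorder Γ]
    (x : Γ → P) (a : P) : Prop :=
  ∃ M N : Set P, IsLUB M a ∧ IsGLB N a ∧
    ∀ m ∈ M, ∀ n ∈ N, ∃ γ₀, ∀ γ, γ₀ ≤ γ → m ≤ x γ ∧ x γ ≤ n

/-- `X` is O₁-closed under κ-sequences (functions from the ordinals below `κ`). -/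
def KappaO1Closed (κ : Cardinal) {P : Type*} [PartialOrder P] (X : Set P) : Prop :=
  ∀ f : {o : Ordinal // o < κ.ord} → P, (∀ i, f i ∈ X) → ∀ a : P, O1Converges f a → a ∈ X

/-- `X` is O₂-closed under κ-sequences. -/
def KappaO2Closed (κ : Cardinal) {P : Type*} [PartialOrder P] (X : Set P) : Prop :=
  ∀ f : {o : Ordinal // o < κ.ord} → P, (∀ i, f i ∈ X) → ∀ a : P, O2Converges f a → a ∈ X

/-- `X` is O₃-closed under κ-sequences. -/
def KappaO3Closed (κ : Cardinal) {P : Type*} [PartialOrder P] (X : Set P) : Prop :=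
  ∀ f : {o : Ordinal // o < κ.ord} → P, (∀ i, f i ∈ X) → ∀ a : P, O3Converges f a → a ∈ X

/-- Let `κ` be a regular (infinite) cardinal and `Λ` the linear order of ordinals below `κ`.
If a κ-sequence `f : Λ → P` converges to `a` with respect to the topology `τ^κ_{Oᵢ}(P)`
whose closed sets are the `O^κᵢ`-closed sets, then there is an isotone map `h : Λ → Λ` with
cofinal range such that `f ∘ h` Oᵢ-converges to `a` (for each `i ∈ {1, 2, 3}`). -/
theorem kappa_sequence_oi_converges_of_tendsto {P : Type*} [PartialOrder P]
    {κ : Cardinal} (hκ : κ.IsRegular)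
    (f : {o : Ordinal // o < κ.ord} → P) (a : P) :
    ((∀ U : Set P, KappaO1Closed κ Uᶜ → a ∈ U → ∃ i₀, ∀ i, i₀ ≤ i → f i ∈ U) →
      ∃ h : {o : Ordinal // o < κ.ord} → {o : Ordinal // o < κ.ord},
        Monotone h ∧ (∀ i, ∃ j, i ≤ h j) ∧ O1Converges (f ∘ h) a) ∧
    ((∀ U : Set P, KappaO2Closed κ Uᶜ → a ∈ U → ∃ i₀, ∀ i, i₀ ≤ i → f i ∈ U) →
      ∃ h : {o : Ordinal // o < κ.ord} → {o : Ordinal // o < κ.ord},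
        Monotone h ∧ (∀ i, ∃ j, i ≤ h j) ∧ O2Converges (f ∘ h) a) ∧
    ((∀ U : Set P, KappaO3Closed κ Uᶜ → a ∈ U → ∃ i₀, ∀ i, i₀ ≤ i → f i ∈ U) →
      ∃ h : {o : Ordinal // o < κ.ord} → {o : Ordinal // o < κ.ord},
        Monotone h ∧ (∀ i, ∃ j, i ≤ h j) ∧ O3Converges (f ∘ h) a) := by

  have hb := kappa_bdd hκ
  have h0 : 0 < κ.ord := by
    have := (Cardinal.isSuccLimit_ord hκ.aleph0_le).bot_lt
    simpa using this
  let o0 : {o : Ordinal // o < κ.ord} := ⟨0, h0⟩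
  refine ⟨fun H => ?_, fun H => ?_, fun H => ?_⟩
  · refine kappa_main hb O1Converges ∅ ?_ ?_ ?_ ?_ ?_ f a H
    · intro v
      have : Nonempty {o : Ordinal // o < κ.ord} := ⟨o0⟩
      exact ⟨fun _ => v, fun _ => v, monotone_const, antitone_const, by simp, by simp, o0,
        fun _ _ => ⟨le_rfl, le_rfl⟩⟩
    · rintro g b p hp ⟨y, z, hy, hz, hyb, hzb, γ, hγ⟩
      refine ⟨y ∘ p, z ∘ p, hy.comp hp.monotone, hz.comp_monotone hp.monotone, ⟨?_, ?_⟩,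
        ⟨?_, ?_⟩, γ, fun j hj => hγ _ (hj.trans hp.le_apply)⟩
      · rintro _ ⟨i, rfl⟩
        exact hyb.1 ⟨_, rfl⟩
      · intro u hu
        refine hyb.2 ?_
        rintro _ ⟨i, rfl⟩
        exact (hy hp.le_apply).trans (hu ⟨i, rfl⟩)
      · rintro _ ⟨i, rfl⟩
        exact hzb.1 ⟨_, rfl⟩
      · intro u hu
        refine hzb.2 ?_
        rintro _ ⟨i, rfl⟩
        exact (hu ⟨i, rfl⟩).trans (hz hp.le_apply)
    · rintro g b - ⟨y, z, hy, hz, hyb, hzb, γ, hγ⟩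
      refine ⟨Set.range y, Set.range z, ⟨_, ⟨o0, rfl⟩⟩, ⟨_, ⟨o0, rfl⟩⟩, hyb, hzb, ?_⟩
      rintro _ ⟨i, rfl⟩ _ ⟨j, rfl⟩
      refine ⟨max γ (max i j), fun k hk => ?_⟩
      have h1 := hγ k ((le_max_left _ _).trans hk)
      have h2 : max i j ≤ k := (le_max_right _ _).trans hk
      exact ⟨(hy ((le_max_left _ _).trans h2)).trans h1.1,
        h1.2.trans (hz ((le_max_right _ _).trans h2))⟩
    · exact fun g b _ _ => ⟨o0, fun _ _ h => h⟩
    · exact fun g b h => h.elim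
  · refine kappa_main hb O2Converges ∅ ?_ ?_ ?_ ?_ ?_ f a H
    · intro v
      refine ⟨{v}, {v}, ⟨v, rfl⟩, ?_, ⟨v, rfl⟩, ?_, isLUB_singleton, isGLB_singleton, ?_⟩
      · rintro _ rfl _ rfl
        exact ⟨_, rfl, le_rfl, le_rfl⟩
      · rintro _ rfl _ rfl
        exact ⟨_, rfl, le_rfl, le_rfl⟩
      · rintro _ rfl _ rfl
        exact ⟨o0, fun _ _ => ⟨le_rfl, le_rfl⟩⟩
    · rintro g b p hp ⟨M, N, h1, h2, h3, h4, h5, h6, h⟩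
      refine ⟨M, N, h1, h2, h3, h4, h5, h6, fun m hm n hn => ?_⟩
      obtain ⟨γ, hγ⟩ := h m hm n hn
      exact ⟨γ, fun j hj => hγ _ (hj.trans hp.le_apply)⟩
    · rintro g b - ⟨M, N, h1, h2, h3, h4, h5, h6, h⟩
      exact ⟨M, N, h1, h3, h5, h6, h⟩
    · exact fun g b _ _ => ⟨o0, fun _ _ h => h⟩
    · exact fun g b h => h.elim
  · have hO : ∀ (g : {o : Ordinal // o < κ.ord} → P) b, b ∉ {x : P | IsBot x ∨ IsTop x} →
        O3Converges g b → O3nConverges g b := by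
      rintro g b hbE ⟨M, N, hM, hN, h⟩
      refine ⟨M, N, ?_, ?_, hM, hN, h⟩
      · by_contra hcon
        rw [Set.not_nonempty_iff_eq_empty] at hcon
        subst hcon
        exact hbE (Or.inl (isLUB_empty_iff.1 hM))
      · by_contra hcon
        rw [Set.not_nonempty_iff_eq_empty] at hcon
        subst hcon
        exact hbE (Or.inr (isGLB_empty_iff.1 hN))
    refine kappa_main hb O3Converges {x | IsBot x ∨ IsTop x} ?_ ?_ hO ?_ ?_ f a H
    · intro v
      refine ⟨{v}, {v}, isLUB_singleton, isGLB_singleton, ?_⟩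
      rintro _ rfl _ rfl
      exact ⟨o0, fun _ _ => ⟨le_rfl, le_rfl⟩⟩
    · rintro g b p hp ⟨M, N, h5, h6, h⟩
      refine ⟨M, N, h5, h6, fun m hm n hn => ?_⟩
      obtain ⟨γ, hγ⟩ := h m hm n hn
      exact ⟨γ, fun j hj => hγ _ (hj.trans hp.le_apply)⟩
    · intro g b hbE hgb
      have hn := hO g b hbE hgb
      have hev : ∀ v : P, v ≠ b → ∃ j0, ∀ j, j0 ≤ j → g j ≠ v := by
        intro v hv
        by_contra hcon
        push Not at hcon
        exact hv (hn.eq_of_freq hcon)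
      have e1 : ∃ j0, ∀ j, j0 ≤ j → ¬ IsBot (g j) := by
        by_cases hx : ∃ v : P, IsBot v
        · obtain ⟨v, hv⟩ := hx
          obtain ⟨j0, hj0⟩ := hev v (fun h => hbE (Or.inl (h ▸ hv)))
          exact ⟨j0, fun j hj hjb => hj0 j hj (le_antisymm (hjb v) (hv _))⟩
        · exact ⟨o0, fun j _ hjb => hx ⟨_, hjb⟩⟩
      have e2 : ∃ j0, ∀ j, j0 ≤ j → ¬ IsTop (g j) := by
        by_cases hx : ∃ v : P, IsTop v
        · obtain ⟨v, hv⟩ := hx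
          obtain ⟨j0, hj0⟩ := hev v (fun h => hbE (Or.inr (h ▸ hv)))
          exact ⟨j0, fun j hj hjb => hj0 j hj (le_antisymm (hv _) (hjb v))⟩
        · exact ⟨o0, fun j _ hjb => hx ⟨_, hjb⟩⟩
      obtain ⟨j1, h1⟩ := e1
      obtain ⟨j2, h2⟩ := e2
      refine ⟨max j1 j2, fun j hj => ?_⟩
      rintro (h | h)
      · exact h1 j ((le_max_left _ _).trans hj) h
      · exact h2 j ((le_max_right _ _).trans hj) h
    · rintro g b (hbot | htop)
      · exact ⟨∅, {b}, isLUB_empty_iff.2 hbot, isGLB_singleton, fun m hm => hm.elim⟩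
      · exact ⟨{b}, ∅, isLUB_singleton, isGLB_empty_iff.2 htop, fun m _ n hn => hn.elim⟩
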